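/- arXiv:1805.01962 — 3 statements merged into one kernel-verified Lean document; each statement's English description precedes it below -/
import Mathlib

section
/- For every t ≥ 0, ∫₀ᵗ e^{−2v}·I₀(2v) dv = t·e^{−2t}·(I₀(2t) + I₁(2t)). -/
open MeasureTheory Filter

noncomputable section

/-- The modified Bessel function of the first kind of order zero,
`I₀(x) = ∑_{k=0}^∞ (x/2)^{2k} / (k!)²`. -/
def besselI0 (x : ℝ) : ℝ :=
  ∑' k : ℕ, (x / 2) ^ (2 * k) / ((Nat.factorial k : ℝ)) ^ 2

/-- The modified Bessel function of the first kind of order one,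
`I₁(x) = ∑_{k=0}^∞ (x/2)^{2k+1} / (k!·(k+1)!)`. -/
def besselI1 (x : ℝ) : ℝ :=
  ∑' k : ℕ, (x / 2) ^ (2 * k + 1) / ((Nat.factorial k : ℝ) * (Nat.factorial (k + 1) : ℝ))

open Nat in
theorem summable_even_pow_div_factorial (x : ℝ) :
    Summable fun k : ℕ => |x| ^ (2 * k + 1) / (k ! : ℝ) := by
  refine ((Real.summable_pow_div_factorial (|x| ^ 2)).mul_left |x|).congr fun k => ?_
  rw [← pow_mul]
  ring

open Nat in
/-- Termwise differentiation of an even power series in `x / 2` without constant term, whose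
coefficients decay factorially. -/
theorem hasDerivAt_tsum_even_pow {c : ℕ → ℝ} (hc : ∀ k, |(k + 1) * c k| ≤ 1 / (k ! : ℝ)) (x : ℝ) :
    HasDerivAt (fun y : ℝ => ∑' k : ℕ, c k * (y / 2) ^ (2 * k + 2))
      (∑' k : ℕ, (k + 1) * c k * (x / 2) ^ (2 * k + 1)) x := by
  have hx : x ∈ Metric.ball (0 : ℝ) (|x| + 1) := by simp
  refine hasDerivAt_tsum_of_isPreconnected (t := Metric.ball (0 : ℝ) (|x| + 1)) (y₀ := 0)
    (g := fun k y => c k * (y / 2) ^ (2 * k + 2))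
    (g' := fun k y => (k + 1) * c k * (y / 2) ^ (2 * k + 1))
    (summable_even_pow_div_factorial (|x| + 1)) Metric.isOpen_ball
    (convex_ball _ _).isPreconnected (fun k y _ => ?_) (fun k y hy => ?_)
    (Metric.mem_ball_self (by positivity)) (by simp [summable_zero]) hx
  · refine ((((hasDerivAt_id y).div_const 2).fun_pow (2 * k + 2)).const_mul (c k)).congr_deriv ?_
    rw [show 2 * k + 2 - 1 = 2 * k + 1 from rfl, id]
    push_cast
    ring
  · have hy' : |y / 2| ≤ |(|x| + 1)| := by
      rw [mem_ball_zero_iff, Real.norm_eq_abs] at hy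
      rw [abs_div, abs_two, abs_of_nonneg (by positivity : 0 ≤ |x| + 1)]
      linarith [abs_nonneg y]
    rw [Real.norm_eq_abs, abs_mul, abs_pow, mul_comm, div_eq_mul_one_div (_ ^ _)]
    exact mul_le_mul (pow_le_pow_left₀ (abs_nonneg _) hy' _) (hc k) (abs_nonneg _) (by positivity)

theorem summable_besselI0 (x : ℝ) :
    Summable fun k : ℕ => (x / 2) ^ (2 * k) / ((Nat.factorial k : ℝ)) ^ 2 := by
  refine .of_nonneg_of_le (fun k => by rw [pow_mul]; positivity) (fun k => ?_)
    (Real.summable_pow_div_factorial ((x / 2) ^ 2))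
  have h : (1 : ℝ) ≤ Nat.factorial k := mod_cast Nat.factorial_pos k
  rw [pow_mul]
  gcongr
  exact le_self_pow₀ h two_ne_zero

theorem hasDerivAt_besselI0 (x : ℝ) : HasDerivAt besselI0 (besselI1 x) x := by
  have h := hasDerivAt_tsum_even_pow (c := fun k => 1 / (Nat.factorial (k + 1) : ℝ) ^ 2)
    (fun k => ?_) x
  · have hI0 : besselI0 = fun y => 1 + ∑' k : ℕ,
        1 / (Nat.factorial (k + 1) : ℝ) ^ 2 * (y / 2) ^ (2 * k + 2) := by
      ext y
      unfold besselI0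
      rw [(summable_besselI0 y).tsum_eq_zero_add]
      congr 1
      · simp
      · exact tsum_congr fun k => by ring
    rw [hI0]
    refine (h.const_add 1).congr_deriv (tsum_congr fun k => ?_)
    rw [Nat.factorial_succ]
    push_cast
    field_simp
  · have h : (1 : ℝ) ≤ Nat.factorial k := mod_cast Nat.factorial_pos k
    rw [abs_of_nonneg (by positivity), Nat.factorial_succ]
    push_cast
    rw [mul_one_div, div_le_div_iff₀ (by positivity) (by positivity)]
    have hk : (1 : ℝ) ≤ k + 1 := by simp
    calc ((k : ℝ) + 1) * Nat.factorial k ≤ ((k : ℝ) + 1) * Nat.factorial k *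
          (((k : ℝ) + 1) * Nat.factorial k) :=
        le_mul_of_one_le_right (by positivity) (one_le_mul_of_one_le_of_one_le hk h)
      _ = _ := by ring

theorem hasDerivAt_half_mul_besselI1 (x : ℝ) :
    HasDerivAt (fun y => y / 2 * besselI1 y) (x / 2 * besselI0 x) x := by
  have h := hasDerivAt_tsum_even_pow
    (c := fun k => 1 / ((Nat.factorial k : ℝ) * Nat.factorial (k + 1))) (fun k => ?_) x
  · have hI1 : (fun y => y / 2 * besselI1 y) = fun y => ∑' k : ℕ,
        1 / ((Nat.factorial k : ℝ) * Nat.factorial (k + 1)) * (y / 2) ^ (2 * k + 2) := by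
      ext y
      rw [besselI1, ← tsum_mul_left]
      exact tsum_congr fun k => by ring
    rw [hI1]
    refine h.congr_deriv ?_
    rw [besselI0, ← tsum_mul_left]
    refine tsum_congr fun k => ?_
    rw [Nat.factorial_succ, pow_succ (x / 2) (2 * k)]
    push_cast
    field_simp
  · have h : (1 : ℝ) ≤ Nat.factorial k := mod_cast Nat.factorial_pos k
    rw [abs_of_nonneg (by positivity), Nat.factorial_succ]
    push_cast
    rw [mul_one_div, div_le_div_iff₀ (by positivity) (by positivity)]
    calc ((k : ℝ) + 1) * Nat.factorial k ≤ ((k : ℝ) + 1) * Nat.factorial k * Nat.factorial k :=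
        le_mul_of_one_le_right (by positivity) h
      _ = _ := by ring

theorem continuous_besselI0 : Continuous besselI0 :=
  continuous_iff_continuousAt.2 fun x => (hasDerivAt_besselI0 x).continuousAt

theorem hasDerivAt_mul_exp_mul_bessel (v : ℝ) :
    HasDerivAt (fun t : ℝ => t * Real.exp (-2 * t) * (besselI0 (2 * t) + besselI1 (2 * t)))
      (Real.exp (-2 * v) * besselI0 (2 * v)) v := by
  have hmul (a : ℝ) : HasDerivAt (fun t : ℝ => a * t) a v := by
    simpa using (hasDerivAt_id v).const_mul a
  have h0 := (hasDerivAt_id' v).fun_mul ((hasDerivAt_besselI0 (2 * v)).comp v (hmul 2))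
  have h1 := (hasDerivAt_half_mul_besselI1 (2 * v)).comp v (hmul 2)
  have hF : (fun t : ℝ => t * Real.exp (-2 * t) * (besselI0 (2 * t) + besselI1 (2 * t))) =
      fun t => Real.exp (-2 * t) * (t * besselI0 (2 * t) + 2 * t / 2 * besselI1 (2 * t)) := by
    ext t
    ring
  rw [hF]
  refine ((hmul (-2)).exp.fun_mul (h0.fun_add h1)).congr_deriv ?_
  simp only [Function.comp_apply]
  ring

/-- variance of the pure directed chain, (4.19): for every `t ≥ 0`,
`∫₀ᵗ e^{-2v}·I₀(2v) dv = t·e^{-2t}·(I₀(2t) + I₁(2t))`. -/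
theorem statement10 (t : ℝ) (ht : 0 ≤ t) :
    ∫ v in (0:ℝ)..t, Real.exp (-2 * v) * besselI0 (2 * v)
      = t * Real.exp (-2 * t) * (besselI0 (2 * t) + besselI1 (2 * t)) := by
  rw [intervalIntegral.integral_eq_sub_of_hasDerivAt
    (fun v _ => hasDerivAt_mul_exp_mul_bessel v)
    (Continuous.intervalIntegrable (by have := continuous_besselI0; fun_prop) _ _)]
  simp
end
end

section
/- For every u ∈ [0,1] and all 0 ≤ s ≤ t, ∑_{k=0}^∞ ∫₀^s [u^k·(t−v)^k·e^{−(t−v)}/k!]·[u^k·(s−v)^k·e^{−(s−v)}/k!] dv = e^{−(t−s)}·∫₀^s e^{−2v}·I₀(2u·√((t−s+v)·v)) dv. -/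
open MeasureTheory Filter

noncomputable section

/-- The series `∑ a ^ k / (k!) ^ 2` converges for `a ≥ 0`. -/
theorem summable_pow_div_factorial_sq {a : ℝ} (ha : 0 ≤ a) :
    Summable fun k : ℕ => a ^ k / (Nat.factorial k : ℝ) ^ 2 := by
  refine (Real.summable_pow_div_factorial a).of_nonneg_of_le (fun k => by positivity) fun k => ?_
  have h1 : (1 : ℝ) ≤ Nat.factorial k := by exact_mod_cast k.factorial_pos
  gcongr
  nlinarith

theorem besselI0_two_mul_sqrt (u : ℝ) {y : ℝ} (hy : 0 ≤ y) :
    besselI0 (2 * u * Real.sqrt y) = ∑' k : ℕ, (u ^ 2 * y) ^ k / (Nat.factorial k : ℝ) ^ 2 := by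
  refine tsum_congr fun k => ?_
  rw [pow_mul, mul_assoc, mul_div_cancel_left₀ _ two_ne_zero, mul_pow u, Real.sq_sqrt hy]

/-- covariance identity (4.22) via the Itô isometry kernels
`p_{0,k}(w; u) = u^k·w^k·e^{-w}/k!`: for every `u ∈ [0,1]` and all `0 ≤ s ≤ t`,
`∑_k ∫₀^s p_{0,k}(t-v; u)·p_{0,k}(s-v; u) dv
  = e^{-(t-s)}·∫₀^s e^{-2v}·I₀(2u√((t-s+v)v)) dv`. -/
theorem statement13 (u : ℝ) (hu : u ∈ Set.Icc (0:ℝ) 1)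
    (s t : ℝ) (hs : 0 ≤ s) (hst : s ≤ t) :
    (∑' k : ℕ, ∫ v in (0:ℝ)..s,
        (u ^ k * (t - v) ^ k * Real.exp (-(t - v)) / (Nat.factorial k : ℝ)) *
        (u ^ k * (s - v) ^ k * Real.exp (-(s - v)) / (Nat.factorial k : ℝ)))
      = Real.exp (-(t - s)) *
          ∫ v in (0:ℝ)..s,
            Real.exp (-2 * v) * besselI0 (2 * u * Real.sqrt ((t - s + v) * v)) := by
  have key : ∀ v ∈ Set.uIoc 0 s, 0 ≤ (t - s + v) * v ∧ (t - s + v) * v ≤ t * s := by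
    intro v hv
    rw [Set.uIoc_of_le hs] at hv
    obtain ⟨h0, h1⟩ := hv
    have h2 : 0 ≤ t - s + v := by linarith
    exact ⟨by positivity, mul_le_mul (by linarith) h1 h0.le (hs.trans hst)⟩
  have hsum : HasSum
      (fun k : ℕ => ∫ v in (0:ℝ)..s,
        Real.exp (-2 * v) * ((u ^ 2 * ((t - s + v) * v)) ^ k / (Nat.factorial k : ℝ) ^ 2))
      (∫ v in (0:ℝ)..s,
        Real.exp (-2 * v) * besselI0 (2 * u * Real.sqrt ((t - s + v) * v))) := by
    have ht : 0 ≤ t := hs.trans hst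
    have hM := summable_pow_div_factorial_sq (a := u ^ 2 * (t * s)) (by positivity)
    refine intervalIntegral.hasSum_integral_of_dominated_convergence
      (fun k _ => (u ^ 2 * (t * s)) ^ k / (Nat.factorial k : ℝ) ^ 2) (fun k => ?_) (fun k => ?_)
      (.of_forall fun v _ => hM) intervalIntegrable_const (.of_forall fun v hv => ?_)
    · exact Continuous.aestronglyMeasurable (by fun_prop)
    · refine .of_forall fun v hv => ?_
      obtain ⟨h0, h1⟩ := key v hv
      rw [Set.uIoc_of_le hs] at hv
      rw [Real.norm_of_nonneg (by positivity)]
      have he : Real.exp (-2 * v) ≤ 1 := Real.exp_le_one_iff.2 (by linarith [hv.1])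
      refine (mul_le_of_le_one_left (by positivity) he).trans ?_
      gcongr
    · have h0 := (key v hv).1
      rw [besselI0_two_mul_sqrt u h0]
      exact (summable_pow_div_factorial_sq (by positivity)).hasSum.mul_left _
  rw [← (hsum.mul_left (Real.exp (-(t - s)))).tsum_eq]
  refine tsum_congr fun k => ?_
  rw [← intervalIntegral.integral_const_mul]
  have hsub := intervalIntegral.integral_comp_sub_left (a := 0) (b := s)
    (fun v => Real.exp (-(t - s)) * (Real.exp (-2 * v) *
      ((u ^ 2 * ((t - s + v) * v)) ^ k / (Nat.factorial k : ℝ) ^ 2))) s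
  rw [sub_self, sub_zero] at hsub
  rw [← hsub]
  refine intervalIntegral.integral_congr fun v _ => ?_
  have he : Real.exp (-(t - s)) * Real.exp (-2 * (s - v)) =
      Real.exp (-(t - v)) * Real.exp (-(s - v)) := by
    rw [← Real.exp_add, ← Real.exp_add]
    ring_nf
  have ht : t - s + (s - v) = t - v := by ring
  simp only [ht, ← mul_assoc (Real.exp (-(t - s))), he, mul_pow, ← pow_mul]
  ring
end
end

section
/- For every fixed s > 0 there exist a constant C > 0 and t₀ ≥ 1 such that for all t ≥ t₀, e^{−(t−s)}·∫₀^s e^{−2v}·I₀(2·√((t−s+v)·v)) dv ≤ C·e^{−(t − 2√((t+s)·s))}·t^{−1/4}. In particular, this quantity tends to 0 as t → ∞. -/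
open MeasureTheory Filter

noncomputable section

theorem besselI0_nonneg (x : ℝ) : 0 ≤ besselI0 x :=
  tsum_nonneg fun k => div_nonneg ((even_two_mul k).pow_nonneg _) (sq_nonneg _)

theorem besselI0_le_cosh (x : ℝ) : besselI0 x ≤ Real.cosh x := by
  have hterm (k : ℕ) :
      (x / 2) ^ (2 * k) / (Nat.factorial k : ℝ) ^ 2 ≤ x ^ (2 * k) / (Nat.factorial (2 * k) : ℝ) := by
    have hx : 0 ≤ x ^ (2 * k) := (even_two_mul k).pow_nonneg _
    have hfac : (Nat.factorial (2 * k) : ℝ) ≤ 2 ^ (2 * k) * (Nat.factorial k : ℝ) ^ 2 := by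
      have h := Nat.choose_mul_factorial_mul_factorial (n := 2 * k) (k := k) (by lia)
      rw [show 2 * k - k = k by lia] at h
      have hc : (2 * k).choose k ≤ 2 ^ (2 * k) := Nat.choose_le_two_pow _ _
      have : Nat.factorial (2 * k) ≤ 2 ^ (2 * k) * Nat.factorial k ^ 2 := by
        rw [← h, mul_assoc, ← sq]
        exact Nat.mul_le_mul_right _ hc
      exact_mod_cast this
    rw [div_pow, div_div]
    exact div_le_div_of_nonneg_left hx (by positivity) hfac
  have hcosh := Real.hasSum_cosh x
  have hsum : Summable fun k : ℕ => (x / 2) ^ (2 * k) / (Nat.factorial k : ℝ) ^ 2 :=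
    .of_nonneg_of_le (fun k => div_nonneg ((even_two_mul k).pow_nonneg _) (sq_nonneg _))
      hterm hcosh.summable
  exact hasSum_le hterm hsum.hasSum hcosh

theorem besselI0_le_exp {x : ℝ} (hx : 0 ≤ x) : besselI0 x ≤ Real.exp x := by
  refine (besselI0_le_cosh x).trans ?_
  rw [Real.cosh_eq]
  have : Real.exp (-x) ≤ Real.exp x := Real.exp_le_exp.2 (by linarith)
  linarith

/-- The tangent line of `v ↦ 2 √(t v)` at `v = s` dominates `2 √((t - s + v) v)` on `[0, s]`. -/
theorem two_mul_sqrt_le_tangent {s t v : ℝ} (hs : 0 < s) (ht : 0 < t) (hv : 0 ≤ v) (hvs : v ≤ s) :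
    2 * √((t - s + v) * v) ≤ 2 * √(t * s) + √t / √s * (v - s) := by
  have hmono : √((t - s + v) * v) ≤ √t * √v := by
    rw [← Real.sqrt_mul ht.le]
    exact Real.sqrt_le_sqrt (by nlinarith)
  have hs' : 0 < √s := Real.sqrt_pos.2 hs
  have hconc : 2 * √v ≤ 2 * √s + (v - s) / √s := by
    rw [← sub_le_iff_le_add', le_div_iff₀ hs']
    nlinarith [sq_nonneg (√v - √s), Real.sq_sqrt hs.le, Real.sq_sqrt hv]
  calc 2 * √((t - s + v) * v) ≤ √t * (2 * √v) := by linarith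
    _ ≤ √t * (2 * √s + (v - s) / √s) := by gcongr
    _ = 2 * √(t * s) + √t / √s * (v - s) := by rw [Real.sqrt_mul ht.le]; ring

theorem integral_exp_mul_sub_le {a s : ℝ} (ha : 0 < a) :
    ∫ v in (0:ℝ)..s, Real.exp (a * (v - s)) ≤ a⁻¹ := by
  have hderiv (v : ℝ) :
      HasDerivAt (fun v => a⁻¹ * Real.exp (a * (v - s))) (Real.exp (a * (v - s))) v := by
    have := ((((hasDerivAt_id v).sub_const s).const_mul a).exp).const_mul a⁻¹
    refine this.congr_deriv ?_
    simp only [id]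
    field_simp
  rw [intervalIntegral.integral_eq_sub_of_hasDerivAt (fun v _ => hderiv v)
    ((by fun_prop : Continuous fun v => Real.exp (a * (v - s))).intervalIntegrable _ _)]
  have : 0 ≤ a⁻¹ * Real.exp (a * (0 - s)) := by positivity
  simpa using this

theorem integral_exp_mul_besselI0_le {s t : ℝ} (hs : 0 < s) (ht : 0 < t) :
    ∫ v in (0:ℝ)..s, Real.exp (-2 * v) * besselI0 (2 * √((t - s + v) * v))
      ≤ Real.exp (2 * √(t * s)) * (√s / √t) := by
  have ha : 0 < √t / √s := by positivity
  calc ∫ v in (0:ℝ)..s, Real.exp (-2 * v) * besselI0 (2 * √((t - s + v) * v))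
      ≤ ∫ v in (0:ℝ)..s, Real.exp (2 * √(t * s)) * Real.exp (√t / √s * (v - s)) := by
        rw [intervalIntegral.integral_of_le hs.le, intervalIntegral.integral_of_le hs.le]
        refine integral_mono_of_nonneg
          (.of_forall fun v => mul_nonneg (Real.exp_nonneg _) (besselI0_nonneg _))
          ((by fun_prop : Continuous fun v =>
            Real.exp (2 * √(t * s)) * Real.exp (√t / √s * (v - s))).integrableOn_Ioc) ?_
        filter_upwards [ae_restrict_mem measurableSet_Ioc] with v ⟨hv, hvs⟩
        rw [← Real.exp_add]
        calc Real.exp (-2 * v) * besselI0 (2 * √((t - s + v) * v))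
            ≤ 1 * Real.exp (2 * √((t - s + v) * v)) :=
              mul_le_mul (Real.exp_le_one_iff.2 (by linarith)) (besselI0_le_exp (by positivity))
                (besselI0_nonneg _) zero_le_one
          _ ≤ Real.exp (2 * √(t * s) + √t / √s * (v - s)) := by
              rw [one_mul]
              exact Real.exp_le_exp.2 (two_mul_sqrt_le_tangent hs ht hv.le hvs)
    _ ≤ Real.exp (2 * √(t * s)) * (√s / √t) := by
        rw [intervalIntegral.integral_const_mul, ← inv_div √t √s]
        gcongr
        exact integral_exp_mul_sub_le ha

theorem exp_mul_integral_besselI0_le {s t : ℝ} (hs : 0 < s) (ht : 1 ≤ t) :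
    Real.exp (-(t - s)) *
        (∫ v in (0:ℝ)..s, Real.exp (-2 * v) * besselI0 (2 * √((t - s + v) * v)))
      ≤ Real.exp s * √s * Real.exp (-(t - 2 * √((t + s) * s))) * t ^ (-(1/4 : ℝ)) := by
  have ht0 : 0 < t := zero_lt_one.trans_le ht
  have hpow : (√t)⁻¹ ≤ t ^ (-(1/4 : ℝ)) := by
    rw [Real.sqrt_eq_rpow, ← Real.rpow_neg ht0.le]
    exact Real.rpow_le_rpow_of_exponent_le ht (by norm_num)
  have hexp : Real.exp (2 * √(t * s)) ≤ Real.exp (2 * √((t + s) * s)) := by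
    gcongr
    linarith
  calc _ ≤ Real.exp (-(t - s)) * (Real.exp (2 * √(t * s)) * (√s / √t)) := by
        gcongr
        exact integral_exp_mul_besselI0_le hs ht0
    _ ≤ Real.exp (-(t - s)) * (Real.exp (2 * √((t + s) * s)) * (√s * t ^ (-(1/4 : ℝ)))) := by
        rw [div_eq_mul_inv]
        gcongr
    _ = _ := by
        rw [show -(t - s) = s + -t by ring,
          show -(t - 2 * √((t + s) * s)) = -t + 2 * √((t + s) * s) by ring,
          Real.exp_add, Real.exp_add]
        ring

theorem exp_neg_sub_two_mul_sqrt_le {s t : ℝ} (hs : 0 ≤ s) (ht : 0 ≤ t) :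
    Real.exp (-(t - 2 * √((t + s) * s))) ≤ Real.exp (5 / 2 * s) * Real.exp (-(t / 2)) := by
  rw [← Real.exp_add, Real.exp_le_exp, Real.sqrt_mul (by positivity)]
  nlinarith [sq_nonneg (√(t + s) - 2 * √s), Real.sq_sqrt hs, Real.sq_sqrt (add_nonneg ht hs)]

/-- decay of the covariance of the pure directed chain: for every fixed
`s > 0` there exist `C > 0` and `t₀ ≥ 1` such that for all `t ≥ t₀`,
`e^{-(t-s)}·∫₀^s e^{-2v}·I₀(2√((t-s+v)v)) dv ≤ C·e^{-(t - 2√((t+s)s))}·t^{-1/4}`;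
in particular this quantity tends to `0` as `t → ∞`. -/
theorem statement14 (s : ℝ) (hs : 0 < s) :
    (∃ C : ℝ, 0 < C ∧ ∃ t₀ : ℝ, 1 ≤ t₀ ∧
      ∀ t : ℝ, t₀ ≤ t →
        Real.exp (-(t - s)) *
            (∫ v in (0:ℝ)..s,
              Real.exp (-2 * v) * besselI0 (2 * Real.sqrt ((t - s + v) * v)))
          ≤ C * Real.exp (-(t - 2 * Real.sqrt ((t + s) * s))) * t ^ (-(1/4 : ℝ))) ∧
    Filter.Tendsto
      (fun t : ℝ =>
        Real.exp (-(t - s)) *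
          ∫ v in (0:ℝ)..s,
            Real.exp (-2 * v) * besselI0 (2 * Real.sqrt ((t - s + v) * v)))
      Filter.atTop (nhds 0) := by
  refine ⟨⟨Real.exp s * √s, by positivity, 1, le_rfl,
    fun t ht => exp_mul_integral_besselI0_le hs ht⟩, ?_⟩
  have hlim : Tendsto
      (fun t : ℝ => Real.exp s * √s * (Real.exp (5 / 2 * s) * Real.exp (-(t / 2)))) atTop
      (nhds 0) := by
    have h : Tendsto (fun t : ℝ => Real.exp (-(t / 2))) atTop (nhds 0) :=
      Real.tendsto_exp_neg_atTop_nhds_zero.comp (tendsto_id.atTop_div_const two_pos)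
    simpa using (h.const_mul (Real.exp (5 / 2 * s))).const_mul (Real.exp s * √s)
  refine tendsto_of_tendsto_of_tendsto_of_le_of_le' tendsto_const_nhds hlim ?_ ?_
  · exact .of_forall fun t => mul_nonneg (Real.exp_nonneg _)
      (intervalIntegral.integral_nonneg hs.le fun v _ =>
        mul_nonneg (Real.exp_nonneg _) (besselI0_nonneg _))
  · filter_upwards [eventually_ge_atTop 1] with t ht
    have ht0 : 0 ≤ t := zero_le_one.trans ht
    calc _ ≤ Real.exp s * √s * Real.exp (-(t - 2 * √((t + s) * s))) * t ^ (-(1/4 : ℝ)) :=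
          exp_mul_integral_besselI0_le hs ht
      _ ≤ Real.exp s * √s * Real.exp (-(t - 2 * √((t + s) * s))) :=
          mul_le_of_le_one_right (by positivity)
            (Real.rpow_le_one_of_one_le_of_nonpos ht (by norm_num))
      _ ≤ Real.exp s * √s * (Real.exp (5 / 2 * s) * Real.exp (-(t / 2))) := by
          gcongr
          exact exp_neg_sub_two_mul_sqrt_le hs.le ht0
end
end
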